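/- Let G be a labelled unit interval graph on D vertices and let i < D be a vertex of G such that m_i + 1 ≤ m_{i+1}, and suppose that for some k ≥ 1 with m_i + k < D the pairs (w_{m_i+1}, m_{m_i+1}) = ⋯ = (w_{m_i+k}, m_{m_i+k}) are all equal. For 0 ≤ j ≤ k let G_j be G together with the added edges {i, b} for m_i + 1 ≤ b ≤ m_i + j. If G_0 and G_k are appendable (e)-positive, then so is every G_j for 0 ≤ j ≤ k. -/

import Mathlib

open scoped Classical
noncomputable section

/-- Words of length `d` in the positive integers. -/
abbrev NCWord (d : ℕ) := Fin d → ℕ+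

/-- `M_d`: coefficient functions of homogeneous degree-`d` series in
noncommuting variables. -/
abbrev Md (d : ℕ) := NCWord d → ℚ

/-- `Y_G`, the chromatic symmetric function of a labelled graph in
noncommuting variables, as an element of `M_d`. -/
def YG {d : ℕ} (G : SimpleGraph (Fin d)) : Md d :=
  fun w => if ∀ j k : Fin d, G.Adj j k → w j ≠ w k then 1 else 0

/-- Set partitions of `{0, …, d-1}`. -/
abbrev SetPtn (d : ℕ) := Finpartition (Finset.univ : Finset (Fin d))

/-- `j` and `k` lie in a common block of `π`. -/
def sameBlock {d : ℕ} (π : SetPtn d) (j k : Fin d) : Prop :=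
  ∃ B ∈ π.parts, j ∈ B ∧ k ∈ B

/-- The elementary symmetric function `e_π` in noncommuting variables. -/
def eSP {d : ℕ} (π : SetPtn d) : Md d :=
  fun w => if ∀ j k : Fin d, j ≠ k → sameBlock π j k → w j ≠ w k then 1 else 0

/-- The block of `π` containing `a`. -/
def blockOf {d : ℕ} (π : SetPtn d) (a : Fin d) : Finset (Fin d) :=
  Finset.univ.filter fun k => sameBlock π a k

/-- The type of a set partition relative to the distinguished element `a`:
the multiset of sizes of the blocks not containing `a` (an integer partition),
together with the size of the block containing `a`. -/
def ptype {d : ℕ} (π : SetPtn d) (a : Fin d) : Multiset ℕ × ℕ :=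
  ((π.parts.erase (blockOf π a)).val.map Finset.card, (blockOf π a).card)

/-- `K_d`: the span of the differences `e_{π₁} - e_{π₂}` over pairs of set
partitions of equal type (relative to the distinguished element `a`). -/
def Ksub {d : ℕ} (a : Fin d) : Submodule ℚ (Md d) :=
  Submodule.span ℚ
    {f | ∃ π₁ π₂ : SetPtn d, ptype π₁ a = ptype π₂ a ∧ f = eSP π₁ - eSP π₂}

/-- `(e)`-positivity of a labelled graph, with distinguished vertex `a`:
`Y_G` is congruent modulo `K_d` to a nonnegative combination of `e_π`'s. -/
def IsEPosNCAt {d : ℕ} (G : SimpleGraph (Fin d)) (a : Fin d) : Prop :=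
  ∃ (s : Finset (SetPtn d)) (c : SetPtn d → ℚ),
    (∀ π, 0 ≤ c π) ∧ YG G - ∑ π ∈ s, c π • eSP π ∈ Ksub a

/-- Induction `↑ : M_d → M_{d+1}`. -/
def induct {d : ℕ} (f : Md d) : Md (d + 1) :=
  fun w => if w (Fin.last d) = w ⟨d - 1, by omega⟩
    then f (fun t => w t.castSucc) else 0

/-- Concatenation of labelled graphs: identify the last vertex of `G` with
the first vertex of `H`. -/
def concatG {p q : ℕ} (G : SimpleGraph (Fin p)) (H : SimpleGraph (Fin q)) :
    SimpleGraph (Fin (p + q - 1)) :=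
  SimpleGraph.fromRel fun a b =>
    (∃ i j : Fin p, G.Adj i j ∧ (a : ℕ) = (i : ℕ) ∧ (b : ℕ) = (j : ℕ)) ∨
    (∃ i j : Fin q, H.Adj i j ∧ (a : ℕ) = (i : ℕ) + (p - 1) ∧ (b : ℕ) = (j : ℕ) + (p - 1))

/-- The reverse graph `G^r`. -/
def revG {d : ℕ} (G : SimpleGraph (Fin d)) : SimpleGraph (Fin d) :=
  SimpleGraph.comap (fun i : Fin d => (⟨d - 1 - (i : ℕ), by have := i.isLt; omega⟩ : Fin d)) G

/-- A labelled graph: a simple graph on vertex set `{0, …, n-1}`, `n ≥ 1`. -/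
structure LGraph where
  n : ℕ
  npos : 0 < n
  G : SimpleGraph (Fin n)

/-- The last vertex of a labelled graph. -/
def LGraph.last (A : LGraph) : Fin A.n := ⟨A.n - 1, by have := A.npos; omega⟩

/-- A labelled graph is `(e)`-positive (at its last vertex). -/
def LGraph.EPosNC (A : LGraph) : Prop := IsEPosNCAt A.G A.last

/-- Concatenation, as an operation on labelled graphs. -/
def LGraph.concat (A B : LGraph) : LGraph :=
  ⟨A.n + B.n - 1, by have := A.npos; have := B.npos; omega, concatG A.G B.G⟩

/-- Reversal, as an operation on labelled graphs. -/
def LGraph.rev (A : LGraph) : LGraph := ⟨A.n, A.npos, revG A.G⟩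

/-- Appendable `(e)`-positivity: `G + H` is `(e)`-positive for every
`(e)`-positive labelled graph `G`. -/
def LGraph.Appendable (H : LGraph) : Prop :=
  ∀ A : LGraph, A.EPosNC → (A.concat H).EPosNC

/-- The chromatic symmetric polynomial of `G` in `n` commuting variables. -/
def cspoly {V : Type} [Fintype V] [DecidableEq V] (G : SimpleGraph V) (n : ℕ) :
    MvPolynomial (Fin n) ℚ :=
  ∑ κ ∈ Finset.univ.filter (fun κ : V → Fin n => ∀ u v : V, G.Adj u v → κ u ≠ κ v),
    ∏ v : V, MvPolynomial.X (κ v)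

/-- `e`-positivity of a finite graph. -/
def EPos {V : Type} [Fintype V] [DecidableEq V] (G : SimpleGraph V) : Prop :=
  ∃ c : Nat.Partition (Fintype.card V) → ℚ, (∀ p, 0 ≤ c p) ∧
    ∀ n : ℕ, cspoly G n =
      ∑ p : Nat.Partition (Fintype.card V),
        c p • (p.parts.map fun r => MvPolynomial.esymm (Fin n) ℚ r).prod

/-- Closed neighbourhood of a vertex, as a finset. -/
def closedNbhd {d : ℕ} (G : SimpleGraph (Fin d)) (i : Fin d) : Finset (Fin d) :=
  Finset.univ.filter fun k => k = i ∨ G.Adj i k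

/-- `m_i`: the largest label in the closed neighbourhood of `i`. -/
def mIdx {d : ℕ} (G : SimpleGraph (Fin d)) (i : Fin d) : Fin d :=
  (closedNbhd G i).max' ⟨i, by simp [closedNbhd]⟩

/-- `w_i`: the smallest label in the closed neighbourhood of `i`. -/
def wIdx {d : ℕ} (G : SimpleGraph (Fin d)) (i : Fin d) : Fin d :=
  (closedNbhd G i).min' ⟨i, by simp [closedNbhd]⟩

/-- Labelled unit interval graph. -/
def IsUnitInterval {d : ℕ} (G : SimpleGraph (Fin d)) : Prop :=
  ∀ i v w j : Fin d, i ≤ v → v < w → w ≤ j → G.Adj i j → G.Adj v w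

/-- An acyclic orientation of a graph, as an asymmetric relation with
irreflexive transitive closure whose symmetrization matches adjacency. -/
def IsAcyclicOrientation {V : Type} (G : SimpleGraph V) (r : V → V → Prop) : Prop :=
  (∀ a b, r a b → ¬ r b a) ∧
  (∀ a b, a ≠ b → ((r a b ∨ r b a) ↔ G.Adj a b)) ∧
  Irreflexive (Relation.TransGen r)

/-- The set of sinks of an orientation. -/
def sinkSet {V : Type} [Fintype V] (r : V → V → Prop) : Finset V :=
  Finset.univ.filter fun x => ∀ y, ¬ r x y

/-- The labelled path `P_d`. -/
def PathG (d : ℕ) : SimpleGraph (Fin d) :=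
  SimpleGraph.fromRel fun a b => (b : ℕ) = (a : ℕ) + 1

/-- The labelled cycle `C_d`. -/
def CycleG (d : ℕ) : SimpleGraph (Fin d) :=
  SimpleGraph.fromRel fun a b => (b : ℕ) = (a : ℕ) + 1 ∨ ((a : ℕ) = 0 ∧ (b : ℕ) = d - 1)

/-- The graph obtained from `G` by adding the edges `{i, b}` for
`M + 1 ≤ b ≤ M + j` (0-indexed labels). -/
def addFanEdges {D : ℕ} (G : SimpleGraph (Fin D)) (i : Fin D) (M j : ℕ) :
    SimpleGraph (Fin D) :=
  SimpleGraph.fromRel fun a b =>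
    G.Adj a b ∨ (a = i ∧ M + 1 ≤ (b : ℕ) ∧ (b : ℕ) ≤ M + j)

/-! ### The span of the elementary functions -/

/-- The power sum function of an equivalence relation: the indicator of the words that are
constant on its classes. -/
def pSetoid {d : ℕ} (r : Setoid (Fin d)) : Md d :=
  fun w => if r ≤ Setoid.ker w then 1 else 0

/-- The elementary function of an equivalence relation: the indicator of the words that are
injective on each of its classes. -/
def eSetoid {d : ℕ} (r : Setoid (Fin d)) : Md d :=
  fun w => if ∀ j k : Fin d, j ≠ k → r j k → w j ≠ w k then 1 else 0

/-- The span of the elementary functions `e_π`. -/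
def eSpan (d : ℕ) : Submodule ℚ (Md d) := Submodule.span ℚ (Set.range eSP)

lemma sameBlock_ofSetoid {d : ℕ} (r : Setoid (Fin d)) (j k : Fin d) :
    sameBlock (Finpartition.ofSetoid r) j k ↔ r j k := by
  constructor
  · rintro ⟨B, hB, hj, hk⟩
    have h1 := Finpartition.part_eq_of_mem _ hB hj
    rw [← Finpartition.mem_part_ofSetoid_iff_rel, h1]
    exact hk
  · intro h
    refine ⟨(Finpartition.ofSetoid r).part j, ?_, ?_, ?_⟩
    · simp
    · simp
    · rw [Finpartition.mem_part_ofSetoid_iff_rel]; exact h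

lemma eSetoid_mem_eSpan {d : ℕ} (r : Setoid (Fin d)) : eSetoid r ∈ eSpan d := by
  refine Submodule.subset_span ⟨Finpartition.ofSetoid r, ?_⟩
  funext w
  simp only [eSP, eSetoid, sameBlock_ofSetoid]

/-- The maps `φ` with `φ k ≤ k` and `φ k` equivalent to `k`. -/
def descents {d : ℕ} (r : Setoid (Fin d)) : Finset (Fin d → Fin d) :=
  Fintype.piFinset fun k => Finset.univ.filter fun j => j ≤ k ∧ r j k

lemma mem_descents {d : ℕ} {r : Setoid (Fin d)} {φ : Fin d → Fin d} :
    φ ∈ descents r ↔ ∀ k, φ k ≤ k ∧ r (φ k) k := by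
  simp [descents]

/-- The equivalence relation generated by `k ∼ φ k`. -/
def orbitSetoid {d : ℕ} (φ : Fin d → Fin d) : Setoid (Fin d) :=
  Relation.EqvGen.setoid fun x y => y = φ x

lemma orbitSetoid_le_iff {d : ℕ} (φ : Fin d → Fin d) (s : Setoid (Fin d)) :
    orbitSetoid φ ≤ s ↔ ∀ x, s x (φ x) := by
  constructor
  · intro h x
    exact h (Relation.EqvGen.rel _ _ rfl)
  · intro h
    exact Setoid.eqvGen_le fun x y hxy => hxy ▸ h x

lemma eSetoid_expand {d : ℕ} (r : Setoid (Fin d)) :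
    eSetoid r = ∑ φ ∈ descents r,
      (∏ k, if φ k = k then (1 : ℚ) else -1) • pSetoid (orbitSetoid φ) := by
  funext w
  have hexp : ∏ k : Fin d, ∑ j ∈ Finset.univ.filter (fun j => j ≤ k ∧ r j k),
        (if j = k then (1 : ℚ) else if w j = w k then -1 else 0) =
      ∑ φ ∈ descents r, ∏ k, (if φ k = k then (1 : ℚ) else if w (φ k) = w k then -1 else 0) :=
    Finset.prod_univ_sum _ _
  have hterm : ∀ φ ∈ descents r,
      ∏ k, (if φ k = k then (1 : ℚ) else if w (φ k) = w k then -1 else 0) =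
      (∏ k, if φ k = k then (1 : ℚ) else -1) * pSetoid (orbitSetoid φ) w := by
    intro φ _
    unfold pSetoid
    simp only [orbitSetoid_le_iff, Setoid.ker_def]
    split_ifs with h
    · rw [mul_one]
      exact Finset.prod_congr rfl fun k _ => by simp [(h k).symm]
    · push Not at h
      obtain ⟨k, hk⟩ := h
      rw [mul_zero]
      refine Finset.prod_eq_zero (Finset.mem_univ k) ?_
      have h1 : φ k ≠ k := fun h => hk (by rw [h])
      simp [h1, Ne.symm hk]
  simp only [Finset.sum_apply, Pi.smul_apply, smul_eq_mul]
  rw [← Finset.sum_congr rfl hterm, ← hexp]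
  unfold eSetoid
  have hsplit : ∀ k : Fin d, ∑ j ∈ Finset.univ.filter (fun j => j ≤ k ∧ r j k),
        (if j = k then (1 : ℚ) else if w j = w k then -1 else 0) =
      1 - ((Finset.univ.filter (fun j => j < k ∧ r j k ∧ w j = w k)).card : ℚ) := by
    intro k
    have hset : Finset.univ.filter (fun j => j ≤ k ∧ r j k) =
        insert k (Finset.univ.filter (fun j => j < k ∧ r j k)) := by
      ext j
      simp only [Finset.mem_filter, Finset.mem_univ, true_and, Finset.mem_insert]
      constructor
      · rintro ⟨h1, h2⟩
        exact h1.eq_or_lt.imp id fun h => ⟨h, h2⟩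
      · rintro (rfl | ⟨h1, h2⟩)
        · exact ⟨le_rfl, r.refl _⟩
        · exact ⟨h1.le, h2⟩
    rw [hset, Finset.sum_insert (by simp), if_pos rfl, sub_eq_add_neg]
    congr 1
    rw [Finset.card_eq_sum_ones, Nat.cast_sum, ← Finset.sum_neg_distrib, Finset.sum_filter,
      Finset.sum_filter]
    refine Finset.sum_congr rfl fun j _ => ?_
    by_cases h1 : j < k
    · by_cases h2 : r j k <;> simp [h1, h1.ne, h2]
    · simp [h1]
  simp only [hsplit]
  split_ifs with h
  · symm
    refine Finset.prod_eq_one fun k _ => ?_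
    rw [Finset.filter_eq_empty_iff.2 fun j _ hj => h j k hj.1.ne hj.2.1 hj.2.2]
    simp
  · have hex : ∃ k : Fin d, ∃ j, j < k ∧ r j k ∧ w j = w k := by
      push Not at h
      obtain ⟨j, k, hjk, hr, hw⟩ := h
      rcases lt_or_gt_of_ne hjk with hlt | hlt
      · exact ⟨k, j, hlt, hr, hw⟩
      · exact ⟨j, k, hlt, r.symm hr, hw.symm⟩
    obtain ⟨k, ⟨j, hj, hr, hw⟩, hmin⟩ :=
      WellFounded.has_min (wellFounded_lt (α := Fin d))
        {k : Fin d | ∃ j, j < k ∧ r j k ∧ w j = w k} hex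
    symm
    refine Finset.prod_eq_zero (Finset.mem_univ k) ?_
    have hone : Finset.univ.filter (fun j => j < k ∧ r j k ∧ w j = w k) = {j} := by
      ext x
      simp only [Finset.mem_filter, Finset.mem_univ, true_and, Finset.mem_singleton]
      constructor
      · rintro ⟨h1, h2, h3⟩
        by_contra hne
        rcases lt_or_gt_of_ne hne with hlt | hlt
        · exact hmin j ⟨x, hlt, r.trans h2 (r.symm hr), h3.trans hw.symm⟩ hj
        · exact hmin x ⟨j, hlt, r.trans hr (r.symm h2), hw.trans h3.symm⟩ h1
      · rintro rfl
        exact ⟨hj, hr, hw⟩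
    rw [hone]
    simp

/-- `k` is the least element of its class. -/
def IsClassMin {d : ℕ} (r : Setoid (Fin d)) (k : Fin d) : Prop := ∀ j, r j k → k ≤ j

lemma exists_isClassMin {d : ℕ} (r : Setoid (Fin d)) (k : Fin d) :
    ∃ m, r m k ∧ IsClassMin r m := by
  obtain ⟨m, hm, hmin⟩ := WellFounded.has_min (wellFounded_lt (α := Fin d))
    {m : Fin d | r m k} ⟨k, r.refl k⟩
  exact ⟨m, hm, fun j hj => not_lt.1 (hmin j (r.trans hj hm))⟩

lemma descents_fixed_of_isClassMin {d : ℕ} {r : Setoid (Fin d)} {φ : Fin d → Fin d}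
    (hφ : φ ∈ descents r) {k : Fin d} (hk : IsClassMin r k) : φ k = k :=
  le_antisymm (mem_descents.1 hφ k).1 (hk _ (mem_descents.1 hφ k).2)

lemma orbitSetoid_le {d : ℕ} {r : Setoid (Fin d)} {φ : Fin d → Fin d}
    (hφ : φ ∈ descents r) : orbitSetoid φ ≤ r :=
  (orbitSetoid_le_iff _ _).2 fun x => r.symm (mem_descents.1 hφ x).2

lemma isClassMin_of_fixed {d : ℕ} {r : Setoid (Fin d)} {φ : Fin d → Fin d}
    (hφ : φ ∈ descents r) (h : orbitSetoid φ = r) {k : Fin d} (hk : φ k = k) :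
    IsClassMin r k := by
  obtain ⟨m, hmk, hm⟩ := exists_isClassMin r k
  let w : Fin d → Prop := fun x => ∃ n, φ^[n] x = k
  have hle : r ≤ Setoid.ker w := by
    rw [← h, orbitSetoid_le_iff]
    intro x
    rw [Setoid.ker_def]
    refine propext ⟨?_, ?_⟩
    · rintro ⟨n, hn⟩
      refine ⟨n, ?_⟩
      rw [← Function.iterate_succ_apply, Function.iterate_succ_apply', hn, hk]
    · rintro ⟨n, hn⟩
      exact ⟨n + 1, by rw [Function.iterate_succ_apply, hn]⟩
  have hw : w m = w k := hle hmk
  obtain ⟨n, hn⟩ : w m := hw ▸ ⟨0, rfl⟩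
  rw [Function.iterate_fixed (descents_fixed_of_isClassMin hφ hm)] at hn
  exact hn ▸ hm

lemma exists_descent_orbitSetoid_eq {d : ℕ} (r : Setoid (Fin d)) :
    ∃ φ ∈ descents r, orbitSetoid φ = r := by
  choose φ hφ hmin using exists_isClassMin r
  have hmem : φ ∈ descents r := mem_descents.2 fun k => ⟨hmin k k (r.symm (hφ k)), hφ k⟩
  refine ⟨φ, hmem, le_antisymm (orbitSetoid_le hmem) fun x y hxy => ?_⟩
  have hrel : ∀ z, orbitSetoid φ z (φ z) := (orbitSetoid_le_iff φ _).1 le_rfl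
  have heq : φ x = φ y := by
    have h1 : r (φ x) (φ y) := r.trans (hφ x) (r.trans hxy (r.symm (hφ y)))
    exact le_antisymm (hmin x _ (r.symm h1)) (hmin y _ h1)
  exact (orbitSetoid φ).trans (hrel x) (heq ▸ (orbitSetoid φ).symm (hrel y))

lemma descent_sign {d : ℕ} {r : Setoid (Fin d)} {φ : Fin d → Fin d}
    (hφ : φ ∈ descents r) (h : orbitSetoid φ = r) :
    (∏ k, if φ k = k then (1 : ℚ) else -1) = ∏ k, if IsClassMin r k then (1 : ℚ) else -1 := by
  refine Finset.prod_congr rfl fun k _ => ?_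
  have : φ k = k ↔ IsClassMin r k :=
    ⟨isClassMin_of_fixed hφ h, descents_fixed_of_isClassMin hφ⟩
  simp only [this]

lemma pSetoid_mem_eSpan {d : ℕ} (r : Setoid (Fin d)) : pSetoid r ∈ eSpan d := by
  have : Finite (Setoid (Fin d)) :=
    Finite.of_injective (fun s : Setoid (Fin d) => (s : Fin d → Fin d → Prop))
      fun s t h => Setoid.ext fun a b => iff_of_eq (congrFun (congrFun h a) b)
  induction r using (wellFounded_lt (α := Setoid (Fin d))).induction with
  | _ r ih =>
    set ε : ℚ := ∏ k, if IsClassMin r k then (1 : ℚ) else -1 with hε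
    have hε0 : ε ≠ 0 := Finset.prod_ne_zero_iff.2 fun k _ => by split_ifs <;> norm_num
    have he := eSetoid_mem_eSpan r
    rw [eSetoid_expand, ← Finset.sum_filter_add_sum_filter_not _
      (fun φ => orbitSetoid φ = r)] at he
    have hrest : ∑ φ ∈ (descents r).filter (fun φ => ¬ orbitSetoid φ = r),
        (∏ k, if φ k = k then (1 : ℚ) else -1) • pSetoid (orbitSetoid φ) ∈ eSpan d := by
      refine Submodule.sum_mem _ fun φ hφ => Submodule.smul_mem _ _ (ih _ ?_)
      rw [Finset.mem_filter] at hφ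
      exact lt_of_le_of_ne (orbitSetoid_le hφ.1) hφ.2
    have hmain : ∑ φ ∈ (descents r).filter (fun φ => orbitSetoid φ = r),
        (∏ k, if φ k = k then (1 : ℚ) else -1) • pSetoid (orbitSetoid φ) =
        ((((descents r).filter (fun φ => orbitSetoid φ = r)).card : ℚ) * ε) • pSetoid r := by
      rw [mul_smul, Nat.cast_smul_eq_nsmul, ← Finset.sum_const]
      refine Finset.sum_congr rfl fun φ hφ => ?_
      rw [Finset.mem_filter] at hφ
      rw [descent_sign hφ.1 hφ.2, hφ.2]
    have hmem := (Submodule.add_mem_iff_left _ hrest).1 he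
    rw [hmain] at hmem
    refine (Submodule.smul_mem_iff _ (mul_ne_zero ?_ hε0)).1 hmem
    obtain ⟨φ, hφ, hr⟩ := exists_descent_orbitSetoid_eq r
    exact Nat.cast_ne_zero.2 (Finset.card_ne_zero_of_mem (Finset.mem_filter.2 ⟨hφ, hr⟩))

lemma pSetoid_mul_prod_mem_eSpan {d : ℕ} (S : Finset (Fin d × Fin d)) (r : Setoid (Fin d)) :
    (fun w : NCWord d => pSetoid r w * ∏ x ∈ S, if w x.1 = w x.2 then (0 : ℚ) else 1) ∈
      eSpan d := by
  induction S using Finset.induction_on generalizing r with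
  | empty => simpa using pSetoid_mem_eSpan r
  | insert x S hx ih =>
    let t : Setoid (Fin d) := Relation.EqvGen.setoid fun a b => a = x.1 ∧ b = x.2
    have ht : ∀ w : NCWord d, t ≤ Setoid.ker w ↔ w x.1 = w x.2 := fun w =>
      ⟨fun h => h (Relation.EqvGen.rel _ _ ⟨rfl, rfl⟩),
        fun h => Setoid.eqvGen_le fun a b hab => by
          rw [Setoid.ker_def, hab.1, hab.2, h]⟩
    convert Submodule.sub_mem _ (ih r) (ih (r ⊔ t)) using 1
    funext w
    simp only [Finset.prod_insert hx, Pi.sub_apply, pSetoid, sup_le_iff, ht]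
    by_cases h1 : r ≤ Setoid.ker w <;> by_cases h2 : w x.1 = w x.2 <;> simp [h1, h2]

lemma YG_mem_eSpan {d : ℕ} (G : SimpleGraph (Fin d)) : YG G ∈ eSpan d := by
  convert pSetoid_mul_prod_mem_eSpan (Finset.univ.filter fun x => G.Adj x.1 x.2) ⊥ using 1
  funext w
  simp only [YG, pSetoid, bot_le, if_true, one_mul]
  split_ifs with h
  · symm
    refine Finset.prod_eq_one fun x hx => if_neg (h _ _ (Finset.mem_filter.1 hx).2)
  · push Not at h
    obtain ⟨j, k, hjk, hw⟩ := h
    symm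
    exact Finset.prod_eq_zero (i := (j, k)) (by simpa using hjk) (if_pos hw)

/-! ### Invariance under relabelling -/

/-- Relabel the elements of a set partition by a permutation. -/
def permPtn {d : ℕ} (τ : Equiv.Perm (Fin d)) (π : SetPtn d) : SetPtn d :=
  (π.map (⟨τ.finsetCongr, by simp⟩ : Finset (Fin d) ≃o Finset (Fin d))).copy
    (Finset.map_univ_equiv τ)

lemma permPtn_parts {d : ℕ} (τ : Equiv.Perm (Fin d)) (π : SetPtn d) :
    (permPtn τ π).parts = π.parts.map τ.finsetCongr.toEmbedding := rfl

lemma sameBlock_permPtn {d : ℕ} (τ : Equiv.Perm (Fin d)) (π : SetPtn d) (j k : Fin d) :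
    sameBlock (permPtn τ π) (τ j) (τ k) ↔ sameBlock π j k := by
  unfold sameBlock
  rw [permPtn_parts]
  constructor
  · rintro ⟨B, hB, hj, hk⟩
    obtain ⟨C, hC, rfl⟩ := Finset.mem_map.1 hB
    exact ⟨C, hC, by simpa using hj, by simpa using hk⟩
  · rintro ⟨B, hB, hj, hk⟩
    exact ⟨_, Finset.mem_map_of_mem _ hB, by simpa using hj, by simpa using hk⟩

lemma blockOf_permPtn {d : ℕ} (τ : Equiv.Perm (Fin d)) (π : SetPtn d) {a : Fin d}
    (ha : τ a = a) : blockOf (permPtn τ π) a = (blockOf π a).map τ.toEmbedding := by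
  ext x
  obtain ⟨y, rfl⟩ := τ.surjective x
  have := sameBlock_permPtn τ π a y
  rw [ha] at this
  simp [blockOf, this]

lemma ptype_permPtn {d : ℕ} (τ : Equiv.Perm (Fin d)) (π : SetPtn d) {a : Fin d}
    (ha : τ a = a) : ptype (permPtn τ π) a = ptype π a := by
  have h : blockOf (permPtn τ π) a = τ.finsetCongr.toEmbedding (blockOf π a) :=
    blockOf_permPtn τ π ha
  unfold ptype
  refine Prod.ext ?_ ?_
  · simp only
    rw [h, permPtn_parts, ← Finset.map_erase, Finset.map_val, Multiset.map_map]
    refine Multiset.map_congr rfl fun B _ => ?_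
    simp
  · simp [blockOf_permPtn τ π ha]

lemma eSP_comp_perm {d : ℕ} (τ : Equiv.Perm (Fin d)) (π : SetPtn d) (w : NCWord d) :
    eSP π (w ∘ τ) = eSP (permPtn τ π) w := by
  unfold eSP
  congr 1
  refine propext ⟨fun h j k hjk hs => ?_, fun h j k hjk hs => ?_⟩
  · obtain ⟨j, rfl⟩ := τ.surjective j
    obtain ⟨k, rfl⟩ := τ.surjective k
    exact h j k (fun e => hjk (e ▸ rfl)) ((sameBlock_permPtn τ π j k).1 hs)
  · exact h _ _ (τ.injective.ne hjk) ((sameBlock_permPtn τ π j k).2 hs)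

/-- Relabelling the positions by a permutation that fixes the distinguished element does not
change a function in the span of the `e_π` modulo `K_d`. -/
lemma sub_comp_perm_mem_Ksub {d : ℕ} (τ : Equiv.Perm (Fin d)) {a : Fin d} (ha : τ a = a)
    {f : Md d} (hf : f ∈ eSpan d) : f - (fun w => f (w ∘ τ)) ∈ Ksub a := by
  induction hf using Submodule.span_induction with
  | mem f hf =>
    obtain ⟨π, rfl⟩ := hf
    refine Submodule.subset_span ⟨π, permPtn τ π, (ptype_permPtn τ π ha).symm, ?_⟩
    simp only [eSP_comp_perm]
  | zero =>
    convert (Ksub a).zero_mem using 1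
    funext w
    simp
  | add f g _ _ hf hg =>
    convert (Ksub a).add_mem hf hg using 1
    funext w
    simp only [Pi.add_apply, Pi.sub_apply]
    ring
  | smul c f _ hf =>
    convert (Ksub a).smul_mem c hf using 1
    funext w
    simp only [Pi.smul_apply, Pi.sub_apply, smul_eq_mul]
    ring

/-! ### Adding edges to twin vertices -/

/-- Proper colourings of a labelled graph. -/
def IsProper {d : ℕ} (G : SimpleGraph (Fin d)) (w : NCWord d) : Prop :=
  ∀ j k : Fin d, G.Adj j k → w j ≠ w k

/-- If `u`, `v` are adjacent twins of `H₀`, then successively adding the edges `{i, u}` and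
`{i, v}` changes `Y` by the same amount modulo `K_d`. -/
lemma YG_twin_second_difference {d : ℕ} {a i u v : Fin d} (H₀ H₁ H₂ : SimpleGraph (Fin d))
    (hau : a ≠ u) (hav : a ≠ v) (hiu : i ≠ u) (hiv : i ≠ v)
    (huv : ∀ w, IsProper H₀ w → w u ≠ w v)
    (htwin : ∀ w : NCWord d, IsProper H₀ (w ∘ Equiv.swap u v) ↔ IsProper H₀ w)
    (h₁ : ∀ w, IsProper H₁ w ↔ IsProper H₀ w ∧ w i ≠ w u)
    (h₂ : ∀ w, IsProper H₂ w ↔ IsProper H₁ w ∧ w i ≠ w v) :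
    YG H₀ - YG H₁ - (YG H₁ - YG H₂) ∈ Ksub a := by
  convert sub_comp_perm_mem_Ksub (Equiv.swap u v) (Equiv.swap_apply_of_ne_of_ne hau hav)
    ((eSpan d).sub_mem (YG_mem_eSpan H₀) (YG_mem_eSpan H₁)) using 2
  funext w
  have hY : ∀ (H : SimpleGraph (Fin d)) (w : NCWord d),
      YG H w = if IsProper H w then 1 else 0 := fun _ _ => if_congr Iff.rfl rfl rfl
  simp only [Pi.sub_apply, hY, h₂, h₁, htwin, Function.comp_apply,
    Equiv.swap_apply_of_ne_of_ne hiu hiv, Equiv.swap_apply_left]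
  have := huv w
  by_cases hp : IsProper H₀ w
  · by_cases hw : w i = w v
    · have h : w i ≠ w u := fun h => this hp (h.symm.trans hw)
      simp [hp, hw, hw ▸ h]
    · simp [hp, hw]
  · simp [hp]

/-- A sequence with vanishing second differences modulo `K` interpolates linearly. -/
lemma interpolation_mem {V : Type*} [AddCommGroup V] [Module ℚ V] (K : Submodule ℚ V)
    (y : ℕ → V) (k : ℕ) (hy : ∀ j, j + 2 ≤ k → y j - y (j + 1) - (y (j + 1) - y (j + 2)) ∈ K)
    (j : ℕ) (hj : j ≤ k) (hk : k ≠ 0) :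
    y j - ((1 - (j / k : ℚ)) • y 0 + (j / k : ℚ) • y k) ∈ K := by
  have hstep : ∀ j, j + 1 ≤ k → (y 0 - y 1) - (y j - y (j + 1)) ∈ K := by
    intro j
    induction j with
    | zero => intro _; simp
    | succ j ih =>
      intro h
      convert K.add_mem (ih (by omega)) (hy j h) using 1
      abel
  have hlin : ∀ j, j ≤ k → (y 0 - y j) - (j : ℚ) • (y 0 - y 1) ∈ K := by
    intro j
    induction j with
    | zero => intro _; simp
    | succ j ih =>
      intro h
      convert K.sub_mem (ih (by omega)) (hstep j h) using 1
      push_cast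
      module
  have hk' : (k : ℚ) ≠ 0 := Nat.cast_ne_zero.2 hk
  convert K.sub_mem (K.smul_mem (j / k : ℚ) (hlin k le_rfl)) (hlin j hj) using 1
  have : (j : ℚ) = (j / k : ℚ) * k := by field_simp
  rw [smul_sub, smul_smul, ← this]
  module

/-- `(e)`-positivity is preserved by nonnegative combinations modulo `K_d`. -/
lemma IsEPosNCAt.of_combination {d : ℕ} {a : Fin d} {H H₀ H₁ : SimpleGraph (Fin d)}
    (h₀ : IsEPosNCAt H₀ a) (h₁ : IsEPosNCAt H₁ a) {s t : ℚ} (hs : 0 ≤ s) (ht : 0 ≤ t)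
    (h : YG H - (s • YG H₀ + t • YG H₁) ∈ Ksub a) : IsEPosNCAt H a := by
  obtain ⟨S₀, c₀, hc₀, hm₀⟩ := h₀
  obtain ⟨S₁, c₁, hc₁, hm₁⟩ := h₁
  refine ⟨S₀ ∪ S₁, fun π => s * (if π ∈ S₀ then c₀ π else 0) + t * (if π ∈ S₁ then c₁ π else 0),
    fun π => ?_, ?_⟩
  · have := hc₀ π
    have := hc₁ π
    positivity
  · convert (Ksub a).add_mem h
      ((Ksub a).add_mem ((Ksub a).smul_mem s hm₀) ((Ksub a).smul_mem t hm₁)) using 1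
    have e₀ : ∑ π ∈ S₀ ∪ S₁, (if π ∈ S₀ then c₀ π else 0) • eSP π = ∑ π ∈ S₀, c₀ π • eSP π := by
      simp only [ite_smul, zero_smul]
      rw [Finset.sum_ite_mem, Finset.union_inter_cancel_left]
    have e₁ : ∑ π ∈ S₀ ∪ S₁, (if π ∈ S₁ then c₁ π else 0) • eSP π = ∑ π ∈ S₁, c₁ π • eSP π := by
      simp only [ite_smul, zero_smul]
      rw [Finset.sum_ite_mem, Finset.union_inter_cancel_right]
    simp only [add_smul, mul_smul, Finset.sum_add_distrib, ← Finset.smul_sum]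
    rw [e₀, e₁]
    module

/-! ### Unit interval graphs and fans -/

lemma IsUnitInterval.adj_iff {d : ℕ} {G : SimpleGraph (Fin d)} (hG : IsUnitInterval G)
    {v x : Fin d} (hx : x ≠ v) : G.Adj v x ↔ wIdx G v ≤ x ∧ x ≤ mIdx G v := by
  have hm : mIdx G v ∈ closedNbhd G v := Finset.max'_mem _ _
  have hw : wIdx G v ∈ closedNbhd G v := Finset.min'_mem _ _
  simp only [closedNbhd, Finset.mem_filter, Finset.mem_univ, true_and] at hm hw
  constructor
  · intro h
    have hmem : x ∈ closedNbhd G v := by simp [closedNbhd, h]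
    exact ⟨Finset.min'_le _ _ hmem, Finset.le_max' _ _ hmem⟩
  · rintro ⟨h1, h2⟩
    rcases lt_or_gt_of_ne hx with hlt | hlt
    · have hadj := hw.resolve_left (lt_of_le_of_lt h1 hlt).ne
      exact (hG _ x v v h1 hlt le_rfl hadj.symm).symm
    · have hadj := hm.resolve_left (lt_of_lt_of_le hlt h2).ne'
      exact hG v v x _ le_rfl hlt h2 hadj

lemma le_mIdx {d : ℕ} (G : SimpleGraph (Fin d)) (v : Fin d) : v ≤ mIdx G v :=
  Finset.le_max' _ _ (by simp [closedNbhd])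

/-- The position of vertex `x` of `A` in a concatenation. -/
def leftPos {p D : ℕ} (hD : 0 < D) (x : Fin p) : Fin (p + D - 1) := ⟨x, by omega⟩

/-- The position of vertex `x` of the second graph in a concatenation. -/
def rightPos {p D : ℕ} (hp : 0 < p) (x : Fin D) : Fin (p + D - 1) := ⟨x + (p - 1), by omega⟩

lemma rightPos_injective {p D : ℕ} (hp : 0 < p) :
    Function.Injective (rightPos (D := D) hp) := by
  intro x y h
  simp only [rightPos, Fin.mk.injEq] at h
  omega

lemma isProper_concatG_iff {p D : ℕ} (hp : 0 < p) (hD : 0 < D) (A : SimpleGraph (Fin p))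
    (H : SimpleGraph (Fin D)) (w : NCWord (p + D - 1)) :
    IsProper (concatG A H) w ↔
      (∀ x y, A.Adj x y → w (leftPos hD x) ≠ w (leftPos hD y)) ∧
      (∀ x y, H.Adj x y → w (rightPos hp x) ≠ w (rightPos hp y)) := by
  constructor
  · intro h
    refine ⟨fun x y hxy => h _ _ ?_, fun x y hxy => h _ _ ?_⟩
    · refine (SimpleGraph.fromRel_adj _ _ _).2 ⟨fun e => hxy.ne ?_, .inl (.inl ⟨x, y, hxy, rfl, rfl⟩)⟩
      simpa [leftPos, Fin.ext_iff] using e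
    · exact (SimpleGraph.fromRel_adj _ _ _).2
        ⟨(rightPos_injective hp).ne hxy.ne, .inl (.inr ⟨x, y, hxy, rfl, rfl⟩)⟩
  · rintro ⟨hA, hH⟩
    have key : ∀ a b : Fin (p + D - 1),
        ((∃ i j : Fin p, A.Adj i j ∧ (a : ℕ) = (i : ℕ) ∧ (b : ℕ) = (j : ℕ)) ∨
        (∃ i j : Fin D, H.Adj i j ∧ (a : ℕ) = (i : ℕ) + (p - 1) ∧
          (b : ℕ) = (j : ℕ) + (p - 1))) → w a ≠ w b := by
      rintro a b (⟨x, y, hxy, ha, hb⟩ | ⟨x, y, hxy, ha, hb⟩)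
      · rw [show a = leftPos hD x from Fin.ext ha, show b = leftPos hD y from Fin.ext hb]
        exact hA x y hxy
      · rw [show a = rightPos hp x from Fin.ext ha, show b = rightPos hp y from Fin.ext hb]
        exact hH x y hxy
    intro a b hab
    rcases ((SimpleGraph.fromRel_adj _ _ _).1 hab).2 with h | h
    · exact key a b h
    · exact (key b a h).symm

lemma isProper_concatG_addFanEdges_iff {p D : ℕ} (hp : 0 < p) (hD : 0 < D)
    (A : SimpleGraph (Fin p)) (G : SimpleGraph (Fin D)) (i : Fin D) {M : ℕ} (hM : (i : ℕ) ≤ M)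
    (j : ℕ) (w : NCWord (p + D - 1)) :
    IsProper (concatG A (addFanEdges G i M j)) w ↔ IsProper (concatG A G) w ∧
      ∀ b : Fin D, M + 1 ≤ (b : ℕ) → (b : ℕ) ≤ M + j → w (rightPos hp i) ≠ w (rightPos hp b) := by
  rw [isProper_concatG_iff hp hD, isProper_concatG_iff hp hD, and_assoc]
  refine and_congr_right fun _ => ⟨fun h => ⟨fun x y hxy => h _ _ ?_, fun b h1 h2 => h _ _ ?_⟩, ?_⟩
  · exact (SimpleGraph.fromRel_adj _ _ _).2 ⟨hxy.ne, .inl (.inl hxy)⟩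
  · refine (SimpleGraph.fromRel_adj _ _ _).2 ⟨?_, .inl (.inr ⟨rfl, h1, h2⟩)⟩
    rintro rfl
    omega
  · rintro ⟨hGw, hfan⟩ x y hxy
    rcases ((SimpleGraph.fromRel_adj _ _ _).1 hxy).2 with (h | ⟨rfl, h1, h2⟩) | (h | ⟨rfl, h1, h2⟩)
    · exact hGw x y h
    · exact hfan y h1 h2
    · exact (hGw y x h).symm
    · exact (hfan x h1 h2).symm

/-- Swapping twin vertices of the second graph, distinct from the shared vertex, preserves
properness of colourings of a concatenation. -/
lemma isProper_concatG_swap {p D : ℕ} (hp : 0 < p) (hD : 0 < D) (A : SimpleGraph (Fin p))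
    (G : SimpleGraph (Fin D)) {u v : Fin D} (hu : 0 < (u : ℕ)) (hv : 0 < (v : ℕ))
    (htwin : ∀ x, x ≠ u → x ≠ v → (G.Adj u x ↔ G.Adj v x)) (w : NCWord (p + D - 1))
    (hw : IsProper (concatG A G) w) :
    IsProper (concatG A G) (w ∘ Equiv.swap (rightPos hp u) (rightPos hp v)) := by
  rw [isProper_concatG_iff hp hD] at hw ⊢
  have hleft : ∀ x : Fin p, Equiv.swap (rightPos hp u) (rightPos hp v) (leftPos hD x) =
      leftPos hD x := fun x => by
    apply Equiv.swap_apply_of_ne_of_ne <;>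
    · simp only [leftPos, rightPos, ne_eq, Fin.mk.injEq]
      omega
  have hright : ∀ x : Fin D, Equiv.swap (rightPos hp u) (rightPos hp v) (rightPos hp x) =
      rightPos hp (Equiv.swap u v x) := fun x =>
    ((rightPos_injective hp).swap_apply u v x)
  have hadj : ∀ x y, G.Adj x y → G.Adj (Equiv.swap u v x) (Equiv.swap u v y) := by
    intro x y hxy
    have hne := hxy.ne
    have hsymm := hxy.symm
    have hx := htwin x
    have hy := htwin y
    simp only [Equiv.swap_apply_def]
    split_ifs <;> subst_vars <;> grind [SimpleGraph.adj_comm]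
  refine ⟨fun x y hxy => ?_, fun x y hxy => ?_⟩
  · simp only [Function.comp_apply, hleft]
    exact hw.1 x y hxy
  · simp only [Function.comp_apply, hright]
    exact hw.2 _ _ (hadj x y hxy)

/-- Consecutive fan edges to adjacent twins change `Y` by the same amount modulo `K_d`. -/
lemma YG_fan_second_difference {p D : ℕ} (hp : 0 < p) (hD : 0 < D) (A : SimpleGraph (Fin p))
    (G : SimpleGraph (Fin D)) (i : Fin D) {M j : ℕ} (hM : (i : ℕ) ≤ M) (hj : M + j + 3 < D)
    (hadj : G.Adj ⟨M + j + 1, by omega⟩ ⟨M + j + 2, by omega⟩)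
    (htwin : ∀ x : Fin D, x ≠ ⟨M + j + 1, by omega⟩ → x ≠ ⟨M + j + 2, by omega⟩ →
      (G.Adj ⟨M + j + 1, by omega⟩ x ↔ G.Adj ⟨M + j + 2, by omega⟩ x))
    (a : Fin (p + D - 1)) (ha : (a : ℕ) = p + D - 1 - 1) :
    YG (concatG A (addFanEdges G i M j)) - YG (concatG A (addFanEdges G i M (j + 1))) -
      (YG (concatG A (addFanEdges G i M (j + 1))) -
        YG (concatG A (addFanEdges G i M (j + 2)))) ∈ Ksub a := by
  set u : Fin D := ⟨M + j + 1, by omega⟩ with hu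
  set v : Fin D := ⟨M + j + 2, by omega⟩ with hv
  have hfan : ∀ (n : ℕ) (x : Fin D), (x : ℕ) = M + n + 1 → ∀ w : NCWord (p + D - 1),
      IsProper (concatG A (addFanEdges G i M (n + 1))) w ↔
        IsProper (concatG A (addFanEdges G i M n)) w ∧
          w (rightPos hp i) ≠ w (rightPos hp x) := by
    intro n x hx w
    rw [isProper_concatG_addFanEdges_iff hp hD A G i hM,
      isProper_concatG_addFanEdges_iff hp hD A G i hM, and_assoc]
    refine and_congr_right fun _ => ⟨fun h => ⟨fun b h1 h2 => h b h1 (by omega),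
      h x (by omega) (by omega)⟩, fun ⟨h, h'⟩ b h1 h2 => ?_⟩
    by_cases hb : (b : ℕ) = M + n + 1
    · rwa [show b = x from Fin.ext (hb.trans hx.symm)]
    · exact h b h1 (by omega)
  have hswap : ∀ w : NCWord (p + D - 1), IsProper (concatG A (addFanEdges G i M j)) w →
      IsProper (concatG A (addFanEdges G i M j))
        (w ∘ Equiv.swap (rightPos hp u) (rightPos hp v)) := by
    intro w hw
    rw [isProper_concatG_addFanEdges_iff hp hD A G i hM] at hw ⊢
    refine ⟨isProper_concatG_swap hp hD A G (Nat.succ_pos _) (Nat.succ_pos _) htwin w hw.1,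
      fun b h1 h2 => ?_⟩
    have hfix : ∀ x : Fin D, (x : ℕ) ≤ M + j →
        Equiv.swap (rightPos hp u) (rightPos hp v) (rightPos hp x) = rightPos hp x :=
      fun x hx => Equiv.swap_apply_of_ne_of_ne
        ((rightPos_injective hp).ne (by rw [hu, Ne, Fin.ext_iff]; simp only; omega))
        ((rightPos_injective hp).ne (by rw [hv, Ne, Fin.ext_iff]; simp only; omega))
    simp only [Function.comp_apply]
    rw [hfix i (by omega), hfix b h2]
    exact hw.2 b h1 h2
  refine YG_twin_second_difference (i := rightPos hp i) (u := rightPos hp u) (v := rightPos hp v)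
    _ _ _ ?_ ?_ ?_ ?_ ?_ ?_ (hfan j u rfl) (hfan (j + 1) v rfl)
  · rw [Ne, Fin.ext_iff]; simp only [rightPos, hu]; omega
  · rw [Ne, Fin.ext_iff]; simp only [rightPos, hv]; omega
  · rw [Ne, Fin.ext_iff]; simp only [rightPos, hu]; omega
  · rw [Ne, Fin.ext_iff]; simp only [rightPos, hv]; omega
  · intro w hw
    exact ((isProper_concatG_iff hp hD _ _ _).1
      ((isProper_concatG_addFanEdges_iff hp hD A G i hM j w).1 hw).1).2 u v hadj
  · intro w
    refine ⟨fun h => ?_, hswap w⟩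
    have := hswap _ h
    rwa [Function.comp_assoc, ← Equiv.coe_trans, Equiv.swap_swap, Equiv.coe_refl,
      Function.comp_id] at this

theorem stmt4 (D : ℕ) (hD : 0 < D) (G : SimpleGraph (Fin D))
    (hG : IsUnitInterval G)
    (i : Fin D) (hi : (i : ℕ) + 1 < D)
    (hm : (mIdx G i : ℕ) + 1 ≤ (mIdx G ⟨(i : ℕ) + 1, hi⟩ : ℕ))
    (k : ℕ) (hk1 : 1 ≤ k) (hkD : (mIdx G i : ℕ) + k + 1 < D)
    (hpairs : ∀ (t : ℕ) (ht1 : 1 ≤ t) (htk : t ≤ k),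
      wIdx G ⟨(mIdx G i : ℕ) + t, by omega⟩ = wIdx G ⟨(mIdx G i : ℕ) + 1, by omega⟩ ∧
      mIdx G ⟨(mIdx G i : ℕ) + t, by omega⟩ = mIdx G ⟨(mIdx G i : ℕ) + 1, by omega⟩)
    (h0 : (LGraph.mk D hD (addFanEdges G i (mIdx G i : ℕ) 0)).Appendable)
    (hk : (LGraph.mk D hD (addFanEdges G i (mIdx G i : ℕ) k)).Appendable) :
    ∀ j ≤ k, (LGraph.mk D hD (addFanEdges G i (mIdx G i : ℕ) j)).Appendable := by
  intro j hj A hA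
  have hM : (i : ℕ) ≤ (mIdx G i : ℕ) := le_mIdx G i
  refine IsEPosNCAt.of_combination (h0 A hA) (hk A hA) (s := 1 - j / k) (t := j / k)
    (sub_nonneg.2 (div_le_one_of_le₀ (by exact_mod_cast hj) (by positivity))) (by positivity)
    (interpolation_mem _ (fun n => YG (concatG A.G (addFanEdges G i (mIdx G i : ℕ) n))) k
      (fun n hn => ?_) j hj (by omega))
  obtain ⟨hw₁, hm₁⟩ := hpairs (n + 1) (by omega) (by omega)
  obtain ⟨hw₂, hm₂⟩ := hpairs (n + 2) (by omega) hn
  have hw := hw₁.trans hw₂.symm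
  have hm := hm₁.trans hm₂.symm
  have hpos : ∀ (x y : Fin D), wIdx G x = wIdx G y → mIdx G x = mIdx G y → x < y → G.Adj x y :=
    fun x y h1 h2 hlt => (hG.adj_iff hlt.ne').2
      ⟨(Finset.min'_le _ _ (by simp [closedNbhd])).trans hlt.le, h2 ▸ le_mIdx G y⟩
  refine YG_fan_second_difference A.npos hD A.G G i hM (by omega) ?_ (fun x hx₁ hx₂ => ?_) _ rfl
  · exact hpos _ _ hw hm (by simp [Fin.lt_def])
  · rw [hG.adj_iff hx₁, hG.adj_iff hx₂]
    exact and_congr (iff_of_eq (congrArg (· ≤ x) hw)) (iff_of_eq (congrArg (x ≤ ·) hm))
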